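/- The normal coordinate ψ of the three-vertex tree with two leaves attached to the root, ψ = φ^{∨} - φ^{T₁}φ^{T₂} + ⅙(φ^{T₁})³, has in the toy model only a simple pole with c-independent residue 7π²/36: for every real c > 0, the limit as ε → 0⁺ of (J(c,ε) - I₁(c,ε)·I₂(c,ε) + ⅙·I₁(c,ε)³ - 7π²/(36ε)) equals -(7π²/12)·log c. -/

import Mathlib

open MeasureTheory Real Filter

noncomputable section

/-- The toy-model integral `I₁(c,ε) = ∫₀^∞ y^{-ε}/(y+c) dy`. -/
def I1 (c ε : ℝ) : ℝ := ∫ y in Set.Ioi (0 : ℝ), y ^ (-ε) / (y + c)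

/-- The nested toy-model integral of the two-vertex ladder tree,
`I₂(c,ε) = ∫₀^∞ (y^{-ε}/(y+c)) I₁(y,ε) dy`. -/
def I2 (c ε : ℝ) : ℝ := ∫ y in Set.Ioi (0 : ℝ), (y ^ (-ε) / (y + c)) * I1 y ε
/-- The toy-model integral of the three-vertex tree whose root carries two
leaves (two disjoint subdivergences with the same external parameter),
`J(c,ε) = ∫₀^∞ (y^{-ε}/(y+c)) I₁(y,ε)² dy`. -/
def J (c ε : ℝ) : ℝ := ∫ y in Set.Ioi (0 : ℝ), (y ^ (-ε) / (y + c)) * (I1 y ε) ^ 2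

/-- The Gamma kernel `t ^ (a - 1) * exp (-(r * t))` with `r > 0` is integrable on `(0, ∞)`. -/
lemma integrableOn_rpow_mul_exp_neg_mul_Ioi {a r : ℝ} (ha : 0 < a) (hr : 0 < r) :
    IntegrableOn (fun t : ℝ => t ^ (a - 1) * exp (-(r * t))) (Set.Ioi 0) := by
  simpa using integrableOn_rpow_mul_exp_neg_mul_rpow (p := 1) (s := a - 1) (b := r)
    (by linarith) one_pos hr

lemma integral_rpow_neg_mul_exp_neg_mul_Ioi {ε t : ℝ} (hε : ε < 1) (ht : 0 < t) :
    ∫ y in Set.Ioi (0 : ℝ), y ^ (-ε) * exp (-(t * y)) = t ^ (ε - 1) * Gamma (1 - ε) := by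
  have h := integral_rpow_mul_exp_neg_mul_Ioi (a := 1 - ε) (by linarith) ht
  rw [show (1 - ε) - 1 = -ε by ring] at h
  rw [h, one_div, inv_rpow ht.le, ← rpow_neg ht.le, neg_sub]

/-- Euler's integral `∫₀^∞ y^{-ε}/(y+c) dy = π / sin (π ε) * c^{-ε}`. -/
lemma I1_eq {c ε : ℝ} (hc : 0 < c) (h0 : 0 < ε) (h1 : ε < 1) :
    I1 c ε = π / sin (π * ε) * c ^ (-ε) := by
  have inner_y : ∀ t ∈ Set.Ioi (0 : ℝ),
      ∫ y in Set.Ioi (0 : ℝ), y ^ (-ε) * exp (-((y + c) * t))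
        = Gamma (1 - ε) * (t ^ (ε - 1) * exp (-(c * t))) := by
    intro t ht
    have h : ∀ y : ℝ, y ^ (-ε) * exp (-((y + c) * t))
        = y ^ (-ε) * exp (-(t * y)) * exp (-(c * t)) := fun y => by
      rw [mul_assoc, ← exp_add]; ring_nf
    simp_rw [h]
    rw [integral_mul_const, integral_rpow_neg_mul_exp_neg_mul_Ioi h1 ht]
    ring
  have inner_t : ∀ y ∈ Set.Ioi (0 : ℝ),
      ∫ t in Set.Ioi (0 : ℝ), y ^ (-ε) * exp (-((y + c) * t)) = y ^ (-ε) / (y + c) := by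
    intro y hy
    have hyc : 0 < y + c := add_pos hy hc
    have h := integral_rpow_mul_exp_neg_mul_Ioi one_pos hyc
    simp only [sub_self, rpow_zero, one_mul, rpow_one, Gamma_one, mul_one] at h
    rw [integral_const_mul, h, mul_one_div]
  have hint : Integrable (Function.uncurry fun y t : ℝ => y ^ (-ε) * exp (-((y + c) * t)))
      ((volume.restrict (Set.Ioi 0)).prod (volume.restrict (Set.Ioi 0))) := by
    rw [integrable_prod_iff' (by
      apply Measurable.aestronglyMeasurable
      simp only [Function.uncurry_def]
      fun_prop)]
    constructor
    · filter_upwards [ae_restrict_mem measurableSet_Ioi] with t ht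
      have h := (integrableOn_rpow_mul_exp_neg_mul_Ioi (a := 1 - ε) (by linarith)
        (Set.mem_Ioi.1 ht)).mul_const (exp (-(c * t)))
      refine h.congr (Eventually.of_forall fun y => ?_)
      simp only [Function.uncurry_apply_pair]
      rw [mul_assoc, ← exp_add]
      ring_nf
    · refine ((integrableOn_rpow_mul_exp_neg_mul_Ioi h0 hc).const_mul (Gamma (1 - ε))).congr ?_
      filter_upwards [ae_restrict_mem measurableSet_Ioi] with t ht
      rw [← inner_y t ht]
      refine setIntegral_congr_fun measurableSet_Ioi fun y hy => ?_
      have hy' : 0 < y := hy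
      simp only [Function.uncurry_apply_pair]
      rw [norm_of_nonneg (by positivity)]
  have swap := integral_integral_swap hint
  rw [setIntegral_congr_fun measurableSet_Ioi inner_t,
    setIntegral_congr_fun measurableSet_Ioi inner_y, integral_const_mul,
    integral_rpow_mul_exp_neg_mul_Ioi h0 hc] at swap
  rw [I1, swap, ← Gamma_mul_Gamma_one_sub, one_div, inv_rpow hc.le, ← rpow_neg hc.le]
  ring

/-- If `f y = A * y^{-δ}` on `(0, ∞)`, then integrating `f` against the toy-model kernel
multiplies the coefficient by the Euler factor at `ε + δ`. -/
lemma integral_kernel_mul {f : ℝ → ℝ} {A c ε δ : ℝ} (hc : 0 < c) (h0 : 0 < ε + δ)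
    (h1 : ε + δ < 1) (hf : ∀ y, 0 < y → f y = A * y ^ (-δ)) :
    ∫ y in Set.Ioi (0 : ℝ), (y ^ (-ε) / (y + c)) * f y
      = A * (π / sin (π * (ε + δ)) * c ^ (-(ε + δ))) := by
  rw [← I1_eq hc h0 h1, I1, ← integral_const_mul]
  refine setIntegral_congr_fun measurableSet_Ioi fun y hy => ?_
  have hy' : 0 < y := hy
  rw [hf y hy', neg_add, rpow_add hy']
  ring

lemma I2_eq {c ε : ℝ} (hc : 0 < c) (h0 : 0 < ε) (h1 : ε < 1 / 2) :
    I2 c ε = π / sin (π * ε) * (π / sin (π * (2 * ε)) * c ^ (-(2 * ε))) := by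
  rw [two_mul]
  exact integral_kernel_mul hc (by linarith) (by linarith)
    fun y hy => I1_eq hy h0 (by linarith)

lemma J_eq {c ε : ℝ} (hc : 0 < c) (h0 : 0 < ε) (h1 : ε < 1 / 3) :
    J c ε = (π / sin (π * ε)) ^ 2 * (π / sin (π * (3 * ε)) * c ^ (-(3 * ε))) := by
  rw [show 3 * ε = ε + 2 * ε by ring]
  refine integral_kernel_mul hc (by linarith) (by linarith) fun y hy => ?_
  rw [I1_eq hy h0 (by linarith), mul_pow, ← rpow_mul_natCast hy.le]
  congr 2
  push_cast
  ring

lemma abs_inv_sin_sub_le {t : ℝ} (h0 : 0 < t) (h1 : t ≤ 1) :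
    |(sin t)⁻¹ - t⁻¹ - t / 6| ≤ t ^ 3 := by
  have hb := sin_bound (x := t) (by rwa [abs_of_pos h0])
  rw [abs_of_pos h0, abs_le] at hb
  have ht3 : t ^ 3 ≤ t := pow_le_of_le_one h0.le h1 three_ne_zero
  have hs : t / 2 ≤ sin t := by linarith [sin_ge_sub_cube h0.le]
  have hs0 : 0 < sin t := by linarith
  have ht5 : 0 < t ^ 5 := by positivity
  have ht2 : t ^ 2 ≤ 1 := pow_le_one₀ h0.le h1
  have key : |6 * t - 6 * sin t - t ^ 2 * sin t| ≤ t ^ 5 := by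
    obtain ⟨d, hd⟩ : ∃ d, d = sin t - (t - t ^ 3 / 6) := ⟨_, rfl⟩
    rw [← hd] at hb
    have hsd : sin t = t - t ^ 3 / 6 + d := by linarith
    rw [hsd, show 6 * t - 6 * (t - t ^ 3 / 6 + d) - t ^ 2 * (t - t ^ 3 / 6 + d)
      = t ^ 5 / 6 - d * (6 + t ^ 2) by ring, abs_le]
    constructor <;> nlinarith [sq_nonneg t]
  have hden : 3 * t ^ 2 ≤ 6 * t * sin t := by nlinarith
  rw [show (sin t)⁻¹ - t⁻¹ - t / 6 = (6 * t - 6 * sin t - t ^ 2 * sin t) / (6 * t * sin t) by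
    field_simp, abs_div, abs_of_pos (show 0 < 6 * t * sin t by positivity),
    div_le_iff₀ (by positivity)]
  calc _ ≤ t ^ 5 := key
    _ ≤ t ^ 3 * (3 * t ^ 2) := by nlinarith
    _ ≤ _ := by gcongr

/-- `π / sin (π k ε) = 1 / (k ε) + π² k ε / 6 + o(ε²)` as `ε → 0⁺`. -/
lemma tendsto_pi_div_sin_remainder {k : ℝ} (hk : 0 < k) :
    Tendsto (fun ε : ℝ => (π / sin (π * (k * ε)) - 1 / (k * ε) - π ^ 2 / 6 * (k * ε)) / ε ^ 2)
      (nhdsWithin 0 (Set.Ioi 0)) (nhds 0) := by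
  have hlim : Tendsto (fun ε : ℝ => π ^ 4 * k ^ 3 * ε) (nhdsWithin 0 (Set.Ioi 0)) (nhds 0) := by
    refine Tendsto.mono_left ?_ nhdsWithin_le_nhds
    exact Continuous.tendsto' (by fun_prop) _ _ (by simp)
  refine squeeze_zero_norm' ?_ hlim
  have hpos : (0 : ℝ) < 1 / (π * k) := by positivity
  filter_upwards [Ioo_mem_nhdsGT hpos] with ε hε
  obtain ⟨h0, h1⟩ := hε
  have ht : π * (k * ε) ≤ 1 := by
    rw [lt_div_iff₀ (by positivity)] at h1
    linarith
  have hb := abs_inv_sin_sub_le (t := π * (k * ε)) (by positivity) ht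
  rw [norm_eq_abs, abs_div, abs_of_pos (show 0 < ε ^ 2 by positivity),
    div_le_iff₀ (by positivity),
    show π / sin (π * (k * ε)) - 1 / (k * ε) - π ^ 2 / 6 * (k * ε)
      = π * ((sin (π * (k * ε)))⁻¹ - (π * (k * ε))⁻¹ - π * (k * ε) / 6) by
      field_simp, abs_mul, abs_of_pos pi_pos]
  calc _ ≤ π * (π * (k * ε)) ^ 3 := by gcongr
    _ = _ := by ring

/-- The `c`-independent coefficient of the normal coordinate has a simple pole with no
constant term. -/
lemma tendsto_cherry_coefficient :
    Tendsto (fun ε : ℝ => (π / sin (π * ε)) ^ 2 * (π / sin (π * (3 * ε)) - π / sin (π * (2 * ε))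
        + 1 / 6 * (π / sin (π * ε))) - 7 * π ^ 2 / (36 * ε))
      (nhdsWithin 0 (Set.Ioi 0)) (nhds 0) := by
  have hu1 := tendsto_pi_div_sin_remainder one_pos
  have hu2 := tendsto_pi_div_sin_remainder two_pos
  have hu3 := tendsto_pi_div_sin_remainder three_pos
  have hid : Tendsto (fun ε : ℝ => ε) (nhdsWithin 0 (Set.Ioi 0)) (nhds 0) :=
    tendsto_id.mono_left nhdsWithin_le_nhds
  have hv := (hid.mul hu1).const_add (π ^ 2 / 6)
  have hw := (hu3.sub hu2).add (hu1.const_mul (1 / 6))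
  have hlim := ((((hid.pow 2).mul hv).const_add 1).pow 2 |>.mul hw).add
    ((((hid.mul hv).const_mul 2).add ((hid.pow 3).mul (hv.pow 2))).const_mul (7 * π ^ 2 / 36))
  refine (hlim.congr' ?_).trans (by simp)
  filter_upwards [self_mem_nhdsWithin] with ε hε
  have hε' : ε ≠ 0 := (Set.mem_Ioi.1 hε).ne'
  simp only [one_mul]
  generalize π / sin (π * ε) = F₁
  generalize π / sin (π * (2 * ε)) = F₂
  generalize π / sin (π * (3 * ε)) = F₃
  field_simp
  ring

/-- The normal coordinate `ψ = φ^{∨} - φ^{T₁}φ^{T₂} + ⅙(φ^{T₁})³` of the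
three-vertex tree with two leaves attached to the root has only a simple pole
with `c`-independent residue `7π²/36`:
`J - I₁·I₂ + ⅙I₁³ - 7π²/(36ε) → -(7π²/12)·log c` as `ε → 0⁺`. -/
theorem toy_model_psi3_cherry (c : ℝ) (hc : 0 < c) :
    Tendsto (fun ε : ℝ =>
        J c ε - I1 c ε * I2 c ε + (1 / 6) * (I1 c ε) ^ 3 - 7 * π ^ 2 / (36 * ε))
      (nhdsWithin 0 (Set.Ioi 0)) (nhds (-(7 * π ^ 2 / 12) * Real.log c)) := by
  have hderiv : HasDerivAt (fun ε : ℝ => c ^ (-(3 * ε))) (-(3 * Real.log c)) 0 := by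
    have h := ((hasDerivAt_id (0 : ℝ)).const_mul 3).neg.const_rpow hc
    simpa [mul_comm] using h
  have hslope := hderiv.tendsto_slope_zero_right
  have hcont : Tendsto (fun ε : ℝ => c ^ (-(3 * ε))) (nhdsWithin 0 (Set.Ioi 0)) (nhds 1) := by
    simpa using hderiv.continuousAt.tendsto.mono_left nhdsWithin_le_nhds
  have hlim := (hcont.mul tendsto_cherry_coefficient).add (hslope.const_mul (7 * π ^ 2 / 36))
  rw [show 1 * 0 + 7 * π ^ 2 / 36 * -(3 * Real.log c) = -(7 * π ^ 2 / 12) * Real.log c by ring]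
    at hlim
  refine hlim.congr' ?_
  filter_upwards [Ioo_mem_nhdsGT (show (0 : ℝ) < 1 / 3 by norm_num)] with ε hε
  obtain ⟨h0, h1⟩ := hε
  rw [J_eq hc h0 h1, I2_eq hc h0 (by linarith), I1_eq hc h0 (by linarith)]
  have e2 : c ^ (-(2 * ε)) = (c ^ (-ε)) ^ 2 := by
    rw [← rpow_mul_natCast hc.le]; push_cast; ring_nf
  have e3 : c ^ (-(3 * ε)) = (c ^ (-ε)) ^ 3 := by
    rw [← rpow_mul_natCast hc.le]; push_cast; ring_nf
  simp only [zero_add, mul_zero, neg_zero, rpow_zero, smul_eq_mul]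
  rw [e2, e3]
  have hε' : ε ≠ 0 := h0.ne'
  generalize c ^ (-ε) = z
  generalize π / sin (π * ε) = F₁
  generalize π / sin (π * (2 * ε)) = F₂
  generalize π / sin (π * (3 * ε)) = F₃
  field_simp
  ring

end
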